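/- Let A be a commutative unital C*-algebra, M a finitely generated projective A-module, and α, β two positive definite A-hermitian inner products on M. Let GL(M,α) (resp. GL(M,β)) denote the group of A-module automorphisms g of M with α(g x, g y) = α(x,y) for all x,y (resp. preserving β). Then there exists an A-module automorphism f of M such that the conjugation map g ↦ f⁻¹ ∘ g ∘ f is a group isomorphism from GL(M,β) onto GL(M,α). -/

import Mathlib

/-- A positive definite `A`-hermitian inner product on an `A`-module `M`. -/
def IsHermitianInnerProduct (A : Type*) [CommRing A] [StarRing A] [PartialOrder A]
    (M : Type*) [AddCommGroup M] [Module A M] (α : M → M → A) : Prop :=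
  (∀ (a : A) (x y z : M), α (a • x + y) z = a * α x z + α y z) ∧
  (∀ x y : M, α y x = star (α x y)) ∧
  (∀ x : M, 0 ≤ α x x) ∧
  (∀ φ : M →ₗ[A] A, ∃! x : M, ∀ y : M, φ y = α y x)

/-- A self-adjoint element `g` of a C⋆-algebra has a compression `x⋆ g x = -c⋆ c` which vanishes
only if `g` is nonnegative. -/
theorem IsSelfAdjoint.exists_star_mul_mul_eq_neg {R : Type*} [CStarAlgebra R]
    [PartialOrder R] [StarOrderedRing R] {g : R} (hg : IsSelfAdjoint g) :
    ∃ x c : R, star x * (g * x) = -(star c * c) ∧ (c = 0 → 0 ≤ g) := by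
  have hx0 : 0 ≤ g⁻ := CFC.negPart_nonneg g
  have hxs : star g⁻ = g⁻ := hx0.isSelfAdjoint.star_eq
  have hgx : g * g⁻ = -(g⁻ * g⁻) := by
    have : g * g⁻ = (g⁺ - g⁻) * g⁻ := by rw [CFC.posPart_sub_negPart g hg]
    rw [this, sub_mul, CFC.posPart_mul_negPart, zero_sub]
  obtain ⟨b, hb, hbx⟩ := CStarAlgebra.nonneg_iff_exists_isSelfAdjoint_and_eq_mul_self.1 hx0
  have hcc : star (b * g⁻) * (b * g⁻) = g⁻ * g⁻ * g⁻ := by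
    rw [star_mul, hxs, hb.star_eq]
    simp only [hbx, mul_assoc]
  refine ⟨g⁻, b * g⁻, by rw [hgx, hcc, hxs, mul_neg, mul_assoc], fun hc => ?_⟩
  rw [← CFC.negPart_eq_zero_iff g hg, ← CStarRing.star_mul_self_eq_zero_iff, hxs,
    ← CStarRing.star_mul_self_eq_zero_iff, star_mul, hxs, ← mul_assoc, ← hcc, hc]
  simp

/-- A self-adjoint matrix over a C⋆-algebra whose quadratic form is nonnegative is nonnegative. -/
theorem CStarMatrix.nonneg_of_forall_sum_nonneg {n A : Type*} [Fintype n] [DecidableEq n]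
    [CStarAlgebra A] [PartialOrder A] [StarOrderedRing A] {G : CStarMatrix n n A}
    (hG : IsSelfAdjoint G)
    (h : ∀ v : n → A, 0 ≤ ∑ i, ∑ j, star (v i) * G i j * v j) : 0 ≤ G := by
  obtain ⟨X, c, key, hc⟩ := hG.exists_star_mul_mul_eq_neg
  refine hc ?_
  have hcol (i : n) : ∑ k, star (c k i) * c k i = 0 := by
    apply le_antisymm _ (Finset.sum_nonneg fun k _ => star_mul_self_nonneg _)
    have h1 := h fun k => X k i
    have h2 := congr_fun (congr_fun key i) i
    rw [CStarMatrix.mul_apply, CStarMatrix.neg_apply, CStarMatrix.mul_apply] at h2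
    simp only [CStarMatrix.mul_apply, CStarMatrix.star_apply, Finset.mul_sum, ← mul_assoc] at h2
    rw [h2] at h1
    exact neg_nonneg.1 h1
  ext k i
  have := (Finset.sum_eq_zero_iff_of_nonneg fun k _ => star_mul_self_nonneg (c k i)).1
    (hcol i) k (Finset.mem_univ k)
  exact (CStarRing.star_mul_self_eq_zero_iff _).1 this

/-- Two strictly positive elements `p`, `q` are congruent, through a unit commuting with every
given `e` that is self-adjoint with respect to both. -/
theorem IsStrictlyPositive.exists_unit_star_mul_mul_eq {R : Type*} [CStarAlgebra R]
    [PartialOrder R] [StarOrderedRing R] {p q e : R} (hp : IsStrictlyPositive p)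
    (hq : IsStrictlyPositive q) (hpe : star e * p = p * e) (hqe : star e * q = q * e) :
    ∃ s : Rˣ, Commute (s : R) e ∧ star (s : R) * p * s = q := by
  obtain ⟨u, hu⟩ := hp.isUnit_cfcSqrt p
  have hus : star (u : R) = u := by rw [hu]; exact (CFC.sqrt_nonneg p).isSelfAdjoint.star_eq
  have huu : (u : R) * u = p := by rw [hu]; exact CFC.sqrt_mul_sqrt_self p hp.nonneg
  have hus' : star (↑u⁻¹ : R) = ↑u⁻¹ := by
    have : star u = u := Units.ext hus
    rw [← Units.coe_star_inv, this]
  obtain ⟨v, hv⟩ := hq.isUnit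
  have hw : IsStrictlyPositive (↑u⁻¹ * q * ↑u⁻¹ : R) := by
    refine IsUnit.isStrictlyPositive ?_ ?_
    · rw [← hv]; exact (u⁻¹ * v * u⁻¹).isUnit
    · simpa only [hus'] using star_left_conjugate_nonneg hq.nonneg (↑u⁻¹ : R)
  obtain ⟨r, hr⟩ := hw.isUnit_cfcSqrt _
  have hrs : star (r : R) = r := by rw [hr]; exact (CFC.sqrt_nonneg _).isSelfAdjoint.star_eq
  have hrr : (r : R) * r = ↑u⁻¹ * q * ↑u⁻¹ := by
    rw [hr]; exact CFC.sqrt_mul_sqrt_self _ hw.nonneg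
  have hinv : e * (↑u⁻¹ * ↑u⁻¹) = ↑u⁻¹ * ↑u⁻¹ * star e := by
    have h1 : (u * u : R) * e * (↑u⁻¹ * ↑u⁻¹) = star e := by
      rw [huu, ← hpe, ← huu]; simp [mul_assoc]
    rw [← h1]; simp [mul_assoc]
  have hcomm : Commute (↑u⁻¹ * q * ↑u⁻¹ : R) (u * e * ↑u⁻¹) := by
    calc ↑u⁻¹ * q * ↑u⁻¹ * (u * e * ↑u⁻¹) = ↑u⁻¹ * (q * e) * ↑u⁻¹ := by simp [mul_assoc]
      _ = u * (↑u⁻¹ * ↑u⁻¹ * star e) * q * ↑u⁻¹ := by rw [← hqe]; simp [mul_assoc]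
      _ = u * e * ↑u⁻¹ * (↑u⁻¹ * q * ↑u⁻¹) := by rw [← hinv]; simp only [mul_assoc]
  have hrcomm : (r : R) * (u * e * ↑u⁻¹) = u * e * ↑u⁻¹ * r := by
    rw [hr, CFC.sqrt_eq_cfc]
    exact (hcomm.cfc_nnreal _).eq
  refine ⟨u⁻¹ * r * u, ?_, ?_⟩
  · calc (↑(u⁻¹ * r * u) : R) * e = ↑u⁻¹ * (r * (u * e * ↑u⁻¹)) * u := by simp [mul_assoc]
      _ = e * ↑(u⁻¹ * r * u) := by rw [hrcomm]; simp [mul_assoc]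
  · have : star (↑(u⁻¹ * r * u) : R) * p * ↑(u⁻¹ * r * u) = u * (r * r) * u := by
      simp only [Units.val_mul, star_mul, hus, hus', hrs, ← huu]
      simp [mul_assoc]
    rw [this, hrr]; simp [mul_assoc]

/-- If `g ≥ 0` is supported on an idempotent `e` and left invertible relative to it, then adding
`(1 - e)⋆ (1 - e)` makes it strictly positive. -/
theorem isStrictlyPositive_add_star_one_sub_mul_self {R : Type*} [CStarAlgebra R]
    [PartialOrder R] [StarOrderedRing R] {g g' e : R} (hg : 0 ≤ g) (he : e * e = e)
    (hge : g * e = g) (hg' : g' * g = e) :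
    IsStrictlyPositive (g + star (1 - e) * (1 - e)) := by
  set f := 1 - e with hf
  have hff : f * f = f := by rw [hf]; noncomm_ring [he]
  have hfs : star f * star f = star f := by rw [← star_mul, hff]
  have hpos : 0 ≤ g + star f * f := add_nonneg hg (star_mul_self_nonneg f)
  refine IsUnit.isStrictlyPositive ?_ hpos
  set z := 1 + star (f - star f) * (f - star f) with hz
  have hzu : IsUnit z :=
    CStarAlgebra.isUnit_of_le 1 (le_add_of_nonneg_right (star_mul_self_nonneg _))
  have hzf : z * f = f * star f * f := by
    simp only [hz, star_sub, star_star, add_mul, mul_sub, sub_mul, mul_assoc, hff, hfs, one_mul]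
    noncomm_ring
  have hfe : f * e = 0 := by rw [hf, sub_mul, one_mul, he, sub_self]
  have hgf : g * f = 0 := by rw [hf, mul_sub, mul_one, hge, sub_self]
  have hfg : star f * g = 0 := by
    rw [← star_eq_zero, star_mul, star_star, hg.isSelfAdjoint.star_eq, hgf]
  obtain ⟨u, hu⟩ := hzu
  have hleft : (g' * star e + ↑u⁻¹ * f * star f) * (g + star f * f) = 1 := by
    have hgs : star e * g = g := by
      rw [← hg.isSelfAdjoint.star_eq, ← star_mul, hge]
    have hse : star e * star f = 0 := by rw [← star_mul, hfe, star_zero]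
    calc _ = g' * (star e * g) + g' * (star e * star f) * f + ↑u⁻¹ * f * (star f * g)
          + ↑u⁻¹ * (f * (star f * star f) * f) := by noncomm_ring
      _ = e + ↑u⁻¹ * (z * f) := by rw [hgs, hse, hfg, hfs, hg', hzf]; simp
      _ = 1 := by rw [← hu, Units.inv_mul_cancel_left, hf]; abel
  have hright := congr_arg star hleft
  rw [star_mul, hpos.isSelfAdjoint.star_eq, star_one] at hright
  exact isUnit_iff_exists_and_exists.2 ⟨⟨_, hright⟩, ⟨_, hleft⟩⟩

namespace IsHermitianInnerProduct

section Algebra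

variable {A : Type*} [CommRing A] [StarRing A] [PartialOrder A]
  {M : Type*} [AddCommGroup M] [Module A M] {α : M → M → A}

theorem eq_star (h : IsHermitianInnerProduct A M α) (x y : M) : α y x = star (α x y) := h.2.1 x y

theorem exists_linearMap (h : IsHermitianInnerProduct A M α) (y : M) :
    ∃ φ : M →ₗ[A] A, ∀ x, φ x = α x y := by
  have hz : α 0 y = 0 := by simpa using h.1 1 0 0 y
  refine ⟨⟨⟨fun x => α x y, fun a b => by simpa using h.1 1 a b y⟩, fun a x => ?_⟩, fun _ => rfl⟩
  simpa [hz] using h.1 a x 0 y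

theorem sum_smul_left (h : IsHermitianInnerProduct A M α) {n : Type*} [Fintype n]
    (v : n → A) (m : n → M) (y : M) : α (∑ i, v i • m i) y = ∑ i, v i * α (m i) y := by
  obtain ⟨φ, hφ⟩ := h.exists_linearMap y
  simp [← hφ]

theorem sum_smul_right (h : IsHermitianInnerProduct A M α) {n : Type*} [Fintype n]
    (x : M) (v : n → A) (m : n → M) :
    α x (∑ i, v i • m i) = ∑ i, star (v i) * α x (m i) := by
  rw [h.eq_star, h.sum_smul_left, star_sum]
  exact Finset.sum_congr rfl fun i _ => by rw [star_mul', ← h.eq_star]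

/-- Every linear map to `A ^ n` is given by pairing with `n` vectors. -/
theorem exists_eq_apply (h : IsHermitianInnerProduct A M α) {n : Type*}
    (σ : M →ₗ[A] n → A) : ∃ u : n → M, ∀ x i, σ x i = α x (u i) := by
  choose u hu using fun i => (h.2.2.2 (LinearMap.proj i ∘ₗ σ)).exists
  exact ⟨u, fun x i => hu i x⟩

end Algebra

/-- The Gram matrix of `α` on a family `m`. -/
def gram {A M n : Type*} (α : M → M → A) (m : n → M) : CStarMatrix n n A :=
  CStarMatrix.ofMatrix fun i j => α (m j) (m i)

theorem apply_sum_smul {A : Type*} [CommRing A] [StarRing A] [PartialOrder A]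
    {M : Type*} [AddCommGroup M] [Module A M] {α : M → M → A}
    (h : IsHermitianInnerProduct A M α) {n : Type*} [Fintype n] (m : n → M) (v w : n → A) :
    α (∑ i, v i • m i) (∑ i, w i • m i) =
      star w ⬝ᵥ ((CStarMatrix.ofMatrix.symm (gram α m)).mulVec v) := by
  rw [h.sum_smul_right]
  refine Finset.sum_congr rfl fun i _ => congr_arg (star (w i) * ·) ?_
  rw [h.sum_smul_left]
  exact Finset.sum_congr rfl fun j _ => mul_comm _ _

section CStar

variable {A : Type*} [CommCStarAlgebra A] [PartialOrder A] [StarOrderedRing A]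
  {M : Type*} [AddCommGroup M] [Module A M] {α β : M → M → A}
  {n : Type*} [Fintype n] [DecidableEq n]

theorem gram_nonneg (h : IsHermitianInnerProduct A M α) (m : n → M) : 0 ≤ gram α m := by
  refine CStarMatrix.nonneg_of_forall_sum_nonneg ?_ fun v => ?_
  · ext i j
    exact (h.eq_star _ _).symm
  · have := h.2.2.1 (∑ i, v i • m i)
    rw [h.apply_sum_smul] at this
    simpa only [dotProduct, Matrix.mulVec, Finset.mul_sum, ← mul_assoc] using! this

/-- If `m` generates `M`, with coordinates given by the section `σ`, then the Gram matrix of `α`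
is invertible relative to the idempotent matrix `σ (m j) i`. -/
theorem isStrictlyPositive_gram_add (h : IsHermitianInnerProduct A M α) {m : n → M}
    {σ : M →ₗ[A] n → A} (hσ : ∀ x, ∑ i, σ x i • m i = x) {e : CStarMatrix n n A}
    (he : ∀ i j, e i j = σ (m j) i) :
    e * e = e ∧ gram α m * e = gram α m ∧
      IsStrictlyPositive (gram α m + star (1 - e) * (1 - e)) := by
  have hee : e * e = e := by
    ext i j
    rw [CStarMatrix.mul_apply, he i j]
    conv_rhs => rw [← hσ (m j)]
    simp [he, mul_comm]
  have hge : gram α m * e = gram α m := by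
    ext i j
    rw [CStarMatrix.mul_apply]
    have := h.sum_smul_left (σ (m j)) m (m i)
    rw [hσ] at this
    refine (Finset.sum_congr rfl fun k _ => ?_).trans this.symm
    rw [he, mul_comm]
    rfl
  obtain ⟨u, hu⟩ := h.exists_eq_apply σ
  refine ⟨hee, hge, isStrictlyPositive_add_star_one_sub_mul_self (h.gram_nonneg m) hee hge
    (g' := gram α u) ?_⟩
  ext i j
  rw [CStarMatrix.mul_apply, he, hu]
  conv_rhs => rw [← hσ (u i), h.sum_smul_right]
  refine Finset.sum_congr rfl fun k _ => ?_
  rw [hu, ← h.eq_star]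
  rfl

/-- Any two positive definite hermitian inner products on a finitely generated projective module
are isometric. -/
theorem exists_isometry [Module.Finite A M] [Module.Projective A M]
    (hα : IsHermitianInnerProduct A M α) (hβ : IsHermitianInnerProduct A M β) :
    ∃ S : M ≃ₗ[A] M, ∀ x y, α (S x) (S y) = β x y := by
  obtain ⟨n, π, hπ⟩ := Module.Finite.exists_fin' A M
  obtain ⟨σ, hπσ⟩ := Module.projective_lifting_property π LinearMap.id hπ
  set m : Fin n → M := fun i => π (Pi.single i 1) with hm
  have hπm (v : Fin n → A) : ∑ i, v i • m i = π v := by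
    conv_rhs => rw [pi_eq_sum_univ' v]
    simp [hm]
  have hσ (x : M) : π (σ x) = x := LinearMap.congr_fun hπσ x
  have hσ' (x : M) : ∑ i, σ x i • m i = x := by rw [hπm, hσ]
  set E : Matrix (Fin n) (Fin n) A := fun i j => σ (m j) i with hE
  have hEv (v : Fin n → A) : E.mulVec v = σ (π v) := by
    ext i
    simp [← hπm, Matrix.mulVec, dotProduct, hE, mul_comm]
  set e : CStarMatrix (Fin n) (Fin n) A := CStarMatrix.ofMatrix E
  obtain ⟨hee, hαe, hp⟩ := hα.isStrictlyPositive_gram_add hσ' (e := e) fun _ _ => rfl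
  obtain ⟨-, hβe, hq⟩ := hβ.isStrictlyPositive_gram_add hσ' (e := e) fun _ _ => rfl
  have hcompl : (1 - e) * e = 0 := by rw [sub_mul, one_mul, hee, sub_self]
  have hPe {γ : M → M → A} (h : gram γ m * e = gram γ m) :
      (gram γ m + star (1 - e) * (1 - e)) * e = gram γ m := by
    rw [add_mul, h, mul_assoc, hcompl, mul_zero, add_zero]
  have hsymm {γ : M → M → A} (hγ : IsHermitianInnerProduct A M γ)
      (h : gram γ m * e = gram γ m) (hs : IsSelfAdjoint (gram γ m + star (1 - e) * (1 - e))) :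
      star e * (gram γ m + star (1 - e) * (1 - e)) =
        (gram γ m + star (1 - e) * (1 - e)) * e := by
    conv_lhs => rw [← hs.star_eq, ← star_mul]
    rw [hPe h, (hγ.gram_nonneg m).isSelfAdjoint.star_eq]
  obtain ⟨s, hse, hs⟩ := hp.exists_unit_star_mul_mul_eq hq (hsymm hα hαe hp.isSelfAdjoint)
    (hsymm hβ hβe hq.isSelfAdjoint)
  have hsg : star (s : CStarMatrix (Fin n) (Fin n) A) * gram α m * s = gram β m := by
    rw [← hPe hβe, ← hs, mul_assoc _ _ e, hse.eq, ← mul_assoc, mul_assoc _ _ e, hPe hαe]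
  let L (t : CStarMatrix (Fin n) (Fin n) A) : M →ₗ[A] M :=
    π ∘ₗ (CStarMatrix.ofMatrix.symm t).mulVecLin ∘ₗ σ
  have hL (t t' : CStarMatrix (Fin n) (Fin n) A) (htt : t * t' = 1) (hte : Commute t e) :
      L t ∘ₗ L t' = LinearMap.id := by
    ext x
    have hmat : t * e * t' = e := by rw [hte.eq, mul_assoc, htt, mul_one]
    have hmat' : CStarMatrix.ofMatrix.symm t * E * CStarMatrix.ofMatrix.symm t' = E := hmat
    change π ((CStarMatrix.ofMatrix.symm t).mulVec
      (σ (π ((CStarMatrix.ofMatrix.symm t').mulVec (σ x))))) = x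
    rw [← hEv, Matrix.mulVec_mulVec, Matrix.mulVec_mulVec, hmat', hEv, hσ, hσ]
  refine ⟨LinearEquiv.ofLinearMap (L s) (L ↑s⁻¹) (hL _ _ s.mul_inv hse)
    (hL _ _ s.inv_mul hse.units_inv_left), fun x y => ?_⟩
  change α (π ((CStarMatrix.ofMatrix.symm (s : CStarMatrix (Fin n) (Fin n) A)).mulVec (σ x)))
    (π ((CStarMatrix.ofMatrix.symm (s : CStarMatrix (Fin n) (Fin n) A)).mulVec (σ y))) = β x y
  set sm : Matrix (Fin n) (Fin n) A :=
    CStarMatrix.ofMatrix.symm (s : CStarMatrix (Fin n) (Fin n) A)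
  have hsg' : sm.conjTranspose * CStarMatrix.ofMatrix.symm (gram α m) * sm =
    CStarMatrix.ofMatrix.symm (gram β m) := hsg
  conv_rhs => rw [← hσ' x, ← hσ' y, hβ.apply_sum_smul, ← hsg']
  rw [← hπm, ← hπm, hα.apply_sum_smul, Matrix.star_mulVec, ← Matrix.dotProduct_mulVec,
    Matrix.mulVec_mulVec, Matrix.mulVec_mulVec, mul_assoc]

end CStar

end IsHermitianInnerProduct

/-- For two positive definite `A`-hermitian inner products `α`, `β` on a finitely
generated projective module `M`, there is an `A`-module automorphism `f` of `M`
such that conjugation `g ↦ f⁻¹ ∘ g ∘ f` is a group isomorphism from `GL(M, β)`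
(the `β`-preserving automorphisms) onto `GL(M, α)`: conjugation by `f` is an
automorphism of the automorphism group of `M`, and it carries an automorphism
`g` into `GL(M, α)` exactly when `g ∈ GL(M, β)`. -/
theorem hermitian_groups_conjugate
    (A : Type*) [NormedCommRing A] [StarRing A] [CStarRing A] [NormedAlgebra ℂ A]
    [StarModule ℂ A] [CompleteSpace A] [PartialOrder A] [StarOrderedRing A]
    (M : Type*) [AddCommGroup M] [Module A M]
    [Module.Finite A M] [Module.Projective A M]
    (α β : M → M → A)
    (hα : IsHermitianInnerProduct A M α) (hβ : IsHermitianInnerProduct A M β) :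
    ∃ f : M ≃ₗ[A] M, ∀ g : M ≃ₗ[A] M,
      (∀ x y : M, β (g x) (g y) = β x y) ↔
        (∀ x y : M,
          α ((f.trans (g.trans f.symm)) x) ((f.trans (g.trans f.symm)) y) =
            α x y) := by
  let _ : CommCStarAlgebra A := {}
  obtain ⟨S, hS⟩ := hα.exists_isometry hβ
  refine ⟨S.symm, fun g => ⟨fun hg x y => ?_, fun hg x y => ?_⟩⟩
  · simpa [hS, hg] using (hS (S.symm x) (S.symm y)).symm
  · simpa [hS] using hg (S x) (S y)
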